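/- Let b_s ≥ 2, L ≥ 1, n = b_s^L, d ≥ 1, and r ≥ 2 with r − 1 ≤ L. Let 0 < ω_1 < ω_2 < ⋯ < ω_r be real numbers, a < b real, and for 1 ≤ k ≤ r, 1 ≤ j ≤ d let g_{kj} : ℝ → ℝ be differentiable with |g'_{kj}(x)| ≤ C_{kj} for all x. Define vectors u_{kj} ∈ ℝ^n by u_{kj}(i) = g_{kj}( (a + i(b−a)/n)/ω_k ), assume each u_{kj} ≠ 0, and set T_k = ⊗_{j=1}^d u_{kj}, T = Σ_{k=1}^r T_k, T̃_k = ⊗_{j=1}^d ave_{k−1}(u_{kj}), and T̃ = T̃_1 + Σ_{k=2}^r ext_{k−1}(T̃_k). Then ‖T − T̃‖ ≤ Σ_{k=2}^r δ_k ‖T_k‖, where δ_k = [ Π_{j=1}^d ( 1 + (b−a) C_{kj} √( (7 b_s^{2(k−1)} − 15 + 8 b_s^{−2(k−1)})/60 ) / ( √n · ω_k · ‖u_{kj}‖ ) ) ] − 1. -/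

import Mathlib

/-- Block-extension of a `d`-dimensional tensor (0-indexed). -/
noncomputable def ext (bs ℓ d : ℕ) (T : (Fin d → ℕ) → ℝ) : (Fin d → ℕ) → ℝ :=
  fun i => T fun j => i j / bs ^ ℓ

/-- One-dimensional block-average of a vector (0-indexed). -/
noncomputable def vave (bs ℓ : ℕ) (u : ℕ → ℝ) : ℕ → ℝ :=
  fun i => ((bs : ℝ) ^ ℓ)⁻¹ * ∑ j : Fin (bs ^ ℓ), u (i * bs ^ ℓ + (j : ℕ))

/-- Euclidean norm of a vector restricted to indices `{0,…,n-1}`. -/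
noncomputable def vnorm (n : ℕ) (u : ℕ → ℝ) : ℝ :=
  Real.sqrt (∑ i : Fin n, u (i : ℕ) ^ 2)

/-- Frobenius norm of a tensor over the grid `{0,…,n-1}^d`. -/
noncomputable def tnorm (n d : ℕ) (T : (Fin d → ℕ) → ℝ) : ℝ :=
  Real.sqrt (∑ i : Fin d → Fin n, T (fun j => (i j : ℕ)) ^ 2)

lemma tnorm_eq_norm (n d : ℕ) (T : (Fin d → ℕ) → ℝ) :
    tnorm n d T =
      ‖(WithLp.toLp 2 (fun i : Fin d → Fin n => T fun j => (i j : ℕ)) :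
        EuclideanSpace ℝ (Fin d → Fin n))‖ := by
  simp [tnorm, EuclideanSpace.norm_eq]

lemma tnorm_sum_le {ι : Type*} (n d : ℕ) (s : Finset ι) (T : ι → (Fin d → ℕ) → ℝ) :
    tnorm n d (fun i => ∑ k ∈ s, T k i) ≤ ∑ k ∈ s, tnorm n d (T k) := by
  simp only [tnorm_eq_norm]
  refine le_trans (le_of_eq ?_) (norm_sum_le s _)
  congr 1
  ext i
  simp

lemma tnorm_prod (n d : ℕ) (u : Fin d → ℕ → ℝ) :
    tnorm n d (fun i => ∏ j, u j (i j)) = ∏ j, vnorm n (u j) := by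
  unfold tnorm vnorm
  rw [← Real.sqrt_prod _ (fun j _ => Finset.sum_nonneg fun i _ => sq_nonneg _),
    Finset.prod_univ_sum, Fintype.piFinset_univ]
  simp only [Finset.prod_pow]

/-- The distance between two elementary tensors, in terms of the distances of their factors. -/
lemma tnorm_prod_add_sub_prod_le (n d : ℕ) (u e : Fin d → ℕ → ℝ) :
    tnorm n d (fun i => ∏ j, (u j (i j) + e j (i j)) - ∏ j, u j (i j))
      ≤ ∏ j, (vnorm n (u j) + vnorm n (e j)) - ∏ j, vnorm n (u j) := by
  classical
  have key : ∀ x y : Fin d → ℝ, ∏ j, (x j + y j) - ∏ j, x j =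
      ∑ t ∈ (Finset.univ : Finset (Fin d)).powerset.erase Finset.univ,
        ∏ j, (if j ∈ t then x j else y j) := by
    intro x y
    rw [Finset.sum_erase_eq_sub (by simp), Finset.prod_add]
    congr 1
    · refine Finset.sum_congr rfl fun t _ => ?_
      rw [Finset.prod_ite]
      congr 2 <;> ext <;> simp
    · simp
  simp only [key]
  refine (tnorm_sum_le _ _ _ _).trans (le_of_eq (Finset.sum_congr rfl fun t _ => ?_))
  have h := tnorm_prod n d fun j => if j ∈ t then u j else e j
  simp only [apply_ite (vnorm n)] at h
  rw [← h]
  congr 1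
  ext i
  refine Finset.prod_congr rfl fun j _ => ?_
  split_ifs <;> rfl

lemma sum_range_sub_mean_sq (m : ℕ) (hm : 0 < m) (f : ℕ → ℝ) :
    ∑ i ∈ Finset.range m, (f i - (m : ℝ)⁻¹ * ∑ j ∈ Finset.range m, f j) ^ 2 =
      (2 * (m : ℝ))⁻¹ * ∑ i ∈ Finset.range m, ∑ j ∈ Finset.range m, (f i - f j) ^ 2 := by
  have hm' : (m : ℝ) ≠ 0 := by positivity
  simp only [sub_sq, Finset.sum_add_distrib, Finset.sum_sub_distrib, Finset.sum_const,
    Finset.card_range, nsmul_eq_mul, ← Finset.sum_mul, ← Finset.mul_sum]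
  field_simp
  ring

lemma sum_range_sum_range_sub_sq (m : ℕ) :
    ∑ i ∈ Finset.range m, ∑ j ∈ Finset.range m, ((i : ℝ) - j) ^ 2 =
      (m : ℝ) ^ 2 * ((m : ℝ) ^ 2 - 1) / 6 := by
  have h1 : ∀ m : ℕ, ∑ i ∈ Finset.range m, (i : ℝ) = m * (m - 1) / 2 := by
    intro m
    induction m with
    | zero => simp
    | succ k ih => rw [Finset.sum_range_succ, ih]; push_cast; ring
  have h2 : ∀ m : ℕ, ∑ i ∈ Finset.range m, (i : ℝ) ^ 2 = m * (m - 1) * (2 * m - 1) / 6 := by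
    intro m
    induction m with
    | zero => simp
    | succ k ih => rw [Finset.sum_range_succ, ih]; push_cast; ring
  simp only [sub_sq, Finset.sum_add_distrib, Finset.sum_sub_distrib, Finset.sum_const,
    Finset.card_range, nsmul_eq_mul, ← Finset.sum_mul, ← Finset.mul_sum, h1, h2]
  ring

/-- A Lipschitz sequence deviates from its mean at most as much as a linear one. -/
lemma sum_range_sub_mean_sq_le (m : ℕ) (hm : 0 < m) (f : ℕ → ℝ) (c : ℝ)
    (hf : ∀ i j, |f i - f j| ≤ c * |(i : ℝ) - j|) :
    ∑ i ∈ Finset.range m, (f i - (m : ℝ)⁻¹ * ∑ j ∈ Finset.range m, f j) ^ 2 ≤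
      m * (c ^ 2 * (((m : ℝ) ^ 2 - 1) / 12)) := by
  have hm' : (0 : ℝ) < m := by positivity
  rw [sum_range_sub_mean_sq m hm]
  calc _ ≤ (2 * (m : ℝ))⁻¹ *
        ∑ i ∈ Finset.range m, ∑ j ∈ Finset.range m, c ^ 2 * ((i : ℝ) - j) ^ 2 := by
        gcongr with i _ j _
        rw [← sq_abs, ← sq_abs ((i : ℝ) - j), ← mul_pow]
        gcongr
        exact hf i j
    _ = _ := by
        simp only [← Finset.mul_sum, sum_range_sum_range_sub_sq]
        field_simp
        ring

lemma sum_range_mul_le (m N : ℕ) (F : ℕ → ℝ) (B : ℝ)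
    (h : ∀ q, ∑ j ∈ Finset.range m, F (q * m + j) ≤ B) :
    ∑ i ∈ Finset.range (N * m), F i ≤ N * B := by
  induction N with
  | zero => simp
  | succ N ih =>
    rw [Nat.succ_mul, Finset.sum_range_add]
    push_cast
    linarith [h N]

/-- The error of block-averaging a Lipschitz vector. -/
lemma vnorm_vave_sub_le (bs k L : ℕ) (hbs : 0 < bs) (hk : k ≤ L) (u : ℕ → ℝ) (c : ℝ) (hc : 0 ≤ c)
    (hu : ∀ i j, |u i - u j| ≤ c * |(i : ℝ) - j|) :
    vnorm (bs ^ L) (fun i => vave bs k u (i / bs ^ k) - u i) ≤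
      √((bs : ℝ) ^ L) * c * √((((bs : ℝ) ^ k) ^ 2 - 1) / 12) := by
  have hm : 0 < bs ^ k := by positivity
  have hsplit : bs ^ L = bs ^ (L - k) * bs ^ k := by rw [← pow_add, Nat.sub_add_cancel hk]
  have hblock := sum_range_mul_le (bs ^ k) (bs ^ (L - k))
    (fun i => (vave bs k u (i / bs ^ k) - u i) ^ 2)
    ((bs ^ k : ℕ) * (c ^ 2 * ((((bs ^ k : ℕ) : ℝ) ^ 2 - 1) / 12))) (fun q => by
      refine le_trans (le_of_eq (Finset.sum_congr rfl fun j hj => ?_))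
        (sum_range_sub_mean_sq_le (bs ^ k) hm (fun j => u (q * bs ^ k + j)) c fun i j => ?_)
      · have hj' : (q * bs ^ k + j) / bs ^ k = q := by
          rw [mul_comm, Nat.mul_add_div hm, Nat.div_eq_of_lt (Finset.mem_range.1 hj), add_zero]
        simp only [hj', vave, Finset.sum_range, Nat.cast_pow]
        ring
      · simpa using hu (q * bs ^ k + i) (q * bs ^ k + j))
  unfold vnorm
  rw [← Finset.sum_range fun i => (vave bs k u (i / bs ^ k) - u i) ^ 2]
  calc _ ≤ √((bs : ℝ) ^ L * (c ^ 2 * ((((bs : ℝ) ^ k) ^ 2 - 1) / 12))) := by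
        refine Real.sqrt_le_sqrt ?_
        rw [hsplit]
        refine hblock.trans (le_of_eq ?_)
        rw [← mul_assoc, ← Nat.cast_mul, ← hsplit]
        push_cast
        rfl
    _ = _ := by
        rw [Real.sqrt_mul (by positivity), Real.sqrt_mul (by positivity), Real.sqrt_sq hc]
        ring

lemma deviation_constant_le (m : ℝ) (hm : 2 ≤ m) :
    (m ^ 2 - 1) / 12 ≤ (7 * m ^ 2 - 15 + 8 * (m ^ 2)⁻¹) / 60 := by
  have h : 0 < m ^ 2 := by positivity
  have h4 : 4 ≤ m ^ 2 := by nlinarith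
  rw [← sub_nonneg]
  have : (7 * m ^ 2 - 15 + 8 * (m ^ 2)⁻¹) / 60 - (m ^ 2 - 1) / 12 =
      (m ^ 2 - 1) * (m ^ 2 - 4) / (30 * m ^ 2) := by
    field_simp
    ring
  rw [this]
  exact div_nonneg (mul_nonneg (by linarith) (by linarith)) (by positivity)

lemma vave_zero (bs : ℕ) (u : ℕ → ℝ) : vave bs 0 u = u := by
  ext i
  simp only [vave, Fin.sum_univ_eq_sum_range (fun j => u (i * bs ^ 0 + j))]
  simp

theorem stmt8 (bs L d r : ℕ) (hbs : 2 ≤ bs) (hL : 1 ≤ L) (hd : 1 ≤ d)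
    (hr : 2 ≤ r) (hrL : r - 1 ≤ L)
    (ω : ℕ → ℝ) (hω0 : 0 < ω 0) (hωmono : ∀ k, k + 1 < r → ω k < ω (k + 1))
    (a b : ℝ) (hab : a < b)
    (g : ℕ → ℕ → ℝ → ℝ) (C : ℕ → ℕ → ℝ)
    (hg : ∀ k < r, ∀ j < d, Differentiable ℝ (g k j))
    (hg' : ∀ k < r, ∀ j < d, ∀ x : ℝ, |deriv (g k j) x| ≤ C k j)
    (u : ℕ → ℕ → ℕ → ℝ)
    (hu : ∀ k j i, u k j i = g k j ((a + ((i : ℝ) + 1) * (b - a) / ((bs : ℝ) ^ L)) / ω k))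
    (hunz : ∀ k < r, ∀ j < d, vnorm (bs ^ L) (u k j) ≠ 0) :
    tnorm (bs ^ L) d (fun i =>
        (∑ k ∈ Finset.range r, ∏ j : Fin d, u k j (i j))
          - ∑ k ∈ Finset.range r,
              ext bs k d (fun i' => ∏ j : Fin d, vave bs k (u k j) (i' j)) i)
      ≤ ∑ k ∈ Finset.Ico 1 r,
          (((∏ j ∈ Finset.range d,
              (1 + (b - a) * C k j *
                  Real.sqrt ((7 * (bs : ℝ) ^ (2 * k) - 15 + 8 * ((bs : ℝ) ^ (2 * k))⁻¹) / 60)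
                / (Real.sqrt ((bs : ℝ) ^ L) * ω k * vnorm (bs ^ L) (u k j)))) - 1)
            * tnorm (bs ^ L) d (fun i => ∏ j : Fin d, u k j (i j))) := by
  have hωpos : ∀ k < r, 0 < ω k := by
    intro k
    induction k with
    | zero => exact fun _ => hω0
    | succ k ih => exact fun hk => (ih (by omega)).trans (hωmono k hk)
  have hC : ∀ k < r, ∀ j < d, 0 ≤ C k j := fun k hk j hj =>
    (abs_nonneg _).trans (hg' k hk j hj 0)
  have hn : (0 : ℝ) < (bs : ℝ) ^ L := by positivity
  have hlip : ∀ k < r, ∀ j < d, ∀ i i' : ℕ,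
      |u k j i - u k j i'| ≤ C k j * (b - a) / ((bs : ℝ) ^ L * ω k) * |(i : ℝ) - i'| := by
    intro k hk j hj i i'
    have hω := hωpos k hk
    have h := Convex.norm_image_sub_le_of_norm_deriv_le (f := g k j) (C := C k j)
      (fun x _ => hg k hk j hj x) (fun x _ => hg' k hk j hj x) convex_univ
      (Set.mem_univ ((a + ((i' : ℝ) + 1) * (b - a) / ((bs : ℝ) ^ L)) / ω k))
      (Set.mem_univ ((a + ((i : ℝ) + 1) * (b - a) / ((bs : ℝ) ^ L)) / ω k))
    rw [← hu, ← hu, Real.norm_eq_abs, Real.norm_eq_abs] at h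
    refine h.trans (le_of_eq ?_)
    have hx : (a + ((i : ℝ) + 1) * (b - a) / ((bs : ℝ) ^ L)) / ω k -
        (a + ((i' : ℝ) + 1) * (b - a) / ((bs : ℝ) ^ L)) / ω k =
        (b - a) / ((bs : ℝ) ^ L * ω k) * ((i : ℝ) - i') := by
      field_simp
      ring
    have hpos : 0 ≤ (b - a) / ((bs : ℝ) ^ L * ω k) :=
      div_nonneg (sub_nonneg.2 hab.le) (by positivity)
    rw [hx, abs_mul, abs_of_nonneg hpos]
    ring
  have hzero : ∀ i : Fin d → ℕ,
      (∑ k ∈ Finset.range r, ∏ j : Fin d, u k j (i j))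
        - ∑ k ∈ Finset.range r, ext bs k d (fun i' => ∏ j : Fin d, vave bs k (u k j) (i' j)) i =
      ∑ k ∈ Finset.Ico 1 r,
        (∏ j : Fin d, u k j (i j) - ∏ j : Fin d, vave bs k (u k j) (i j / bs ^ k)) := by
    intro i
    rw [← Finset.sum_sub_distrib, Finset.range_eq_Ico,
      Finset.sum_eq_sum_Ico_succ_bot (by omega : 0 < r)]
    simp [ext, vave_zero]
  simp only [hzero]
  refine (tnorm_sum_le _ _ _ _).trans (Finset.sum_le_sum fun k hk => ?_)
  obtain ⟨hk1, hkr⟩ := Finset.mem_Ico.1 hk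
  have hω := hωpos k hkr
  have hdiff := tnorm_prod_add_sub_prod_le (bs ^ L) d (fun j => u k j)
    (fun j i => vave bs k (u k j) (i / bs ^ k) - u k j i)
  simp only [add_sub_cancel] at hdiff
  have hcomm : tnorm (bs ^ L) d (fun i =>
        ∏ j : Fin d, u k j (i j) - ∏ j : Fin d, vave bs k (u k j) (i j / bs ^ k)) =
      tnorm (bs ^ L) d (fun i =>
        ∏ j : Fin d, vave bs k (u k j) (i j / bs ^ k) - ∏ j : Fin d, u k j (i j)) := by
    unfold tnorm
    simp only [sub_sq_comm]
  rw [tnorm_prod (bs ^ L) d (fun j => u k j), hcomm]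
  refine hdiff.trans ?_
  rw [sub_mul, one_mul, Finset.prod_range, ← Finset.prod_mul_distrib]
  refine sub_le_sub_right (Finset.prod_le_prod (fun j _ => ?_) fun j _ => ?_) _
  · exact add_nonneg (Real.sqrt_nonneg _) (Real.sqrt_nonneg _)
  have hv : 0 < vnorm (bs ^ L) (u k j) :=
    (Real.sqrt_nonneg _).lt_of_ne' (hunz k hkr j j.2)
  have hc : 0 ≤ C k j * (b - a) / ((bs : ℝ) ^ L * ω k) :=
    div_nonneg (mul_nonneg (hC k hkr j j.2) (sub_nonneg.2 hab.le)) (by positivity)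
  have herr := vnorm_vave_sub_le bs k L (by omega) (by omega) (u k j) _ hc (hlip k hkr j j.2)
  have hm : (2 : ℝ) ≤ (bs : ℝ) ^ k := by
    exact_mod_cast hbs.trans (Nat.le_self_pow (by omega) bs)
  have hconst := Real.sqrt_le_sqrt (deviation_constant_le _ hm)
  rw [add_mul, one_mul, mul_comm 2 k, pow_mul]
  refine add_le_add_right (herr.trans ((mul_le_mul_of_nonneg_left hconst
    (mul_nonneg (Real.sqrt_nonneg _) hc)).trans (le_of_eq ?_))) _
  have hs : √((bs : ℝ) ^ L) ≠ 0 := (Real.sqrt_pos.2 hn).ne'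
  have hcoef : √((bs : ℝ) ^ L) * (C k j * (b - a) / ((bs : ℝ) ^ L * ω k)) =
      C k j * (b - a) / (√((bs : ℝ) ^ L) * ω k) := by
    nth_rewrite 2 [← Real.mul_self_sqrt hn.le]
    field_simp
  rw [hcoef]
  field_simp
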